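/- For any two lines l, m ∈ L the vector δ_l − δ_m lies in the radical {u ∈ ℂ^(P ⊔ L) : ⟨u, v⟩ = 0 for all v} of the form, and the linear span of the vectors δ_l − δ_m (over all pairs of lines l, m) is exactly this radical and has dimension 12. -/

import Mathlib

open scoped Classical

namespace AllcockStmt13

noncomputable section

/-- `θ = i√3`. -/
def θ : ℂ := Complex.I * Real.sqrt 3

/-- The points of the projective plane `ℙ²(𝔽₃)`. -/
abbrev Pt := {W : Submodule (ZMod 3) (Fin 3 → ZMod 3) // Module.finrank (ZMod 3) W = 1}

/-- The lines of the projective plane `ℙ²(𝔽₃)`. -/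
abbrev Ln := {W : Submodule (ZMod 3) (Fin 3 → ZMod 3) // Module.finrank (ZMod 3) W = 2}

/-- The Gram matrix `G(I_26)` of the incidence diagram of `ℙ²(𝔽₃)`. -/
def G : Matrix (Pt ⊕ Ln) (Pt ⊕ Ln) ℂ := fun u v =>
  match u, v with
  | Sum.inl p, Sum.inl q => if p = q then 3 else 0
  | Sum.inl p, Sum.inr l => if p.1 ≤ l.1 then θ else 0
  | Sum.inr l, Sum.inl p => if p.1 ≤ l.1 then -θ else 0
  | Sum.inr l, Sum.inr m => if l = m then 3 else 0

/-- The sesquilinear form `⟨u, v⟩ = Σ_{i,j} u_i · G_{ij} · conj (v_j)` on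
`ℂ^(P ⊔ L)`. -/
def B (u v : (Pt ⊕ Ln) → ℂ) : ℂ :=
  ∑ i, ∑ j, u i * G i j * (starRingEnd ℂ) (v j)

/-- The standard basis vector `ε_i` of `ℂ^(P ⊔ L)`. -/
def ε (i : Pt ⊕ Ln) : (Pt ⊕ Ln) → ℂ := Pi.single i 1

/-- `δ_l = -θ·ε_l + Σ_{p ⊆ l} ε_p`. -/
def δ (l : Ln) : (Pt ⊕ Ln) → ℂ :=
  (-θ) • ε (Sum.inr l) +
    ∑ p ∈ Finset.univ.filter (fun p : Pt => p.1 ≤ l.1), ε (Sum.inl p)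

/-- The radical of the form: all `u` with `⟨u, v⟩ = 0` for every `v`. -/
def Rad : Set ((Pt ⊕ Ln) → ℂ) := {u | ∀ v, B u v = 0}

lemma theta_mul_theta : θ * θ = -3 := by
  have h : ((Real.sqrt 3 : ℝ) : ℂ) * (Real.sqrt 3 : ℝ) = 3 := by
    rw [← Complex.ofReal_mul, Real.mul_self_sqrt (by norm_num)]
    norm_num
  calc θ * θ = (Complex.I * Complex.I) * ((Real.sqrt 3 : ℝ) * (Real.sqrt 3 : ℝ)) := by
        unfold θ
        ring
    _ = -3 := by
        rw [h, Complex.I_mul_I]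
        ring

lemma theta_ne_zero : θ ≠ 0 := by
  intro h
  have := theta_mul_theta
  rw [h] at this
  norm_num at this

/-! ### Incidence combinatorics of `ℙ²(𝔽₃)` -/

section Incidence

variable {K V : Type*} [Field K] [AddCommGroup V] [Module K V]

/-- One-dimensional subspaces of `V` contained in `W` correspond to one-dimensional
subspaces of `W`. -/
def finrankOneLeEquiv (W : Submodule K V) :
    {p : {U : Submodule K V // Module.finrank K U = 1} // p.1 ≤ W} ≃
      {U : Submodule K W // Module.finrank K U = 1} where
  toFun p := ⟨p.1.1.comap W.subtype, by
    rw [(Submodule.comapSubtypeEquivOfLe p.2).finrank_eq]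
    exact p.1.2⟩
  invFun U := ⟨⟨U.1.map W.subtype, by
    rw [← (Submodule.equivMapOfInjective W.subtype W.injective_subtype U.1).finrank_eq]
    exact U.2⟩, Submodule.map_subtype_le _ _⟩
  left_inv p := by
    ext1
    ext1
    simpa [Submodule.map_comap_subtype] using p.2
  right_inv U := by
    ext1
    exact Submodule.comap_map_eq_of_injective W.injective_subtype _

lemma natCard_finrank_one_le [Finite K] (W : Submodule K V) :
    Nat.card {p : {U : Submodule K V // Module.finrank K U = 1} // p.1 ≤ W} =
      ∑ i ∈ Finset.range (Module.finrank K W), Nat.card K ^ i := by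
  rw [Nat.card_congr ((finrankOneLeEquiv W).trans (Projectivization.equivSubmodule K W).symm),
    Projectivization.card_of_finrank K W rfl]

/-- A hyperplane of `V` corresponds to a one-dimensional subspace of the dual of `V`. -/
def hyperplaneEquiv [FiniteDimensional K V] {n : ℕ} (h : Module.finrank K V = n + 1) :
    {W : Submodule K V // Module.finrank K W = n} ≃
      {U : Submodule K (Module.Dual K V) // Module.finrank K U = 1} :=
  Equiv.subtypeEquiv
    ((Subspace.orderIsoFiniteDimensional (K := K) (V := V)).toEquiv.trans OrderDual.ofDual)
    fun W => by
      have := Subspace.finrank_add_finrank_dualAnnihilator_eq W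
      change _ ↔ Module.finrank K W.dualAnnihilator = 1
      omega

end Incidence

lemma card_Ln : Fintype.card Ln = 13 := by
  have h : Module.finrank (ZMod 3) (Fin 3 → ZMod 3) = 2 + 1 := by simp
  rw [Fintype.card_eq_nat_card, Nat.card_congr ((hyperplaneEquiv h).trans
    (Projectivization.equivSubmodule _ _).symm),
    Projectivization.card_of_finrank (n := 3) _ _ (by rw [Subspace.dual_finrank_eq, h])]
  simp [Finset.sum_range_succ]

lemma finrank_inf_eq_one {l m : Ln} (h : l ≠ m) :
    Module.finrank (ZMod 3) (l.1 ⊓ m.1 : Submodule (ZMod 3) (Fin 3 → ZMod 3)) = 1 := by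
  have h1 := Submodule.finrank_sup_add_finrank_inf_eq l.1 m.1
  have h2 : Module.finrank (ZMod 3) (l.1 ⊔ m.1 : Submodule (ZMod 3) (Fin 3 → ZMod 3)) ≤ 3 := by
    simpa using Submodule.finrank_le (l.1 ⊔ m.1)
  have h3 : 2 < Module.finrank (ZMod 3) (l.1 ⊔ m.1 : Submodule (ZMod 3) (Fin 3 → ZMod 3)) := by
    by_contra hc
    have hl : l.1 = l.1 ⊔ m.1 :=
      Submodule.eq_of_le_of_finrank_le le_sup_left (by rw [l.2]; omega)
    have hm : m.1 = l.1 ⊔ m.1 :=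
      Submodule.eq_of_le_of_finrank_le le_sup_right (by rw [m.2]; omega)
    exact h (Subtype.ext (hl.trans hm.symm))
  rw [l.2, m.2] at h1
  omega

/-- Two lines share four points if they are equal and one point otherwise. -/
lemma sum_incidence (l m : Ln) :
    ∑ p : Pt, (if p.1 ≤ l.1 then (1 : ℂ) else 0) * (if p.1 ≤ m.1 then 1 else 0) =
      1 + if l = m then 3 else 0 := by
  have key : ∑ p : Pt, (if p.1 ≤ l.1 then (1 : ℂ) else 0) * (if p.1 ≤ m.1 then 1 else 0) =
      (Nat.card {p : Pt // p.1 ≤ l.1 ⊓ m.1} : ℂ) := by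
    rw [Nat.card_eq_fintype_card, Fintype.card_subtype, ← Finset.sum_boole]
    refine Finset.sum_congr rfl fun p _ => ?_
    by_cases h1 : p.1 ≤ l.1 <;> by_cases h2 : p.1 ≤ m.1 <;> simp [h1, h2]
  rw [key, natCard_finrank_one_le]
  by_cases h : l = m
  · subst h
    rw [inf_idem, l.2]
    norm_num [Finset.sum_range_succ]
  · rw [finrank_inf_eq_one h]
    simp [h]

/-! ### The vectors `δ_l` and the radical -/

lemma delta_inl (l : Ln) (q : Pt) : δ l (Sum.inl q) = if q.1 ≤ l.1 then 1 else 0 := by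
  simp [δ, ε, Pi.single_apply, Finset.sum_apply]

lemma delta_inr (l m : Ln) : δ l (Sum.inr m) = if l = m then -θ else 0 := by
  rw [← neg_zero, ← apply_ite Neg.neg]
  simp [δ, ε, Pi.single_apply, Finset.sum_apply, eq_comm]

lemma mem_Rad_iff (u : (Pt ⊕ Ln) → ℂ) : u ∈ Rad ↔ ∀ j, ∑ i, u i * G i j = 0 := by
  have hB : ∀ v, B u v = ∑ j, (∑ i, u i * G i j) * (starRingEnd ℂ) (v j) := fun v => by
    simp only [B, Finset.sum_mul]
    exact Finset.sum_comm
  constructor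
  · intro h j
    have := h (Pi.single j 1)
    rw [hB, Finset.sum_eq_single j] at this
    · simpa using this
    · intro k _ hk
      simp [hk]
    · simp
  · intro h v
    simp [hB, h]

lemma sum_mul_G_inl (u : (Pt ⊕ Ln) → ℂ) (q : Pt) :
    ∑ i, u i * G i (Sum.inl q) =
      3 * u (Sum.inl q) - θ * ∑ l : Ln, u (Sum.inr l) * if q.1 ≤ l.1 then 1 else 0 := by
  rw [Fintype.sum_sum_type, sub_eq_add_neg, Finset.mul_sum, ← Finset.sum_neg_distrib]
  congr 1
  · simp [G, mul_comm]
  · refine Finset.sum_congr rfl fun l _ => ?_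
    simp only [G]
    split_ifs <;> ring

lemma sum_mul_G_inr (u : (Pt ⊕ Ln) → ℂ) (m : Ln) :
    ∑ i, u i * G i (Sum.inr m) =
      θ * (∑ p : Pt, u (Sum.inl p) * if p.1 ≤ m.1 then 1 else 0) + 3 * u (Sum.inr m) := by
  rw [Fintype.sum_sum_type, Finset.mul_sum]
  congr 1
  · refine Finset.sum_congr rfl fun p _ => ?_
    simp only [G]
    split_ifs <;> ring
  · simp [G, mul_comm]

lemma sum_delta_mul_G_inl (l : Ln) (q : Pt) : ∑ i, δ l i * G i (Sum.inl q) = 0 := by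
  rw [sum_mul_G_inl]
  simp only [delta_inl, delta_inr, ite_mul, zero_mul, Finset.sum_ite_eq, Finset.mem_univ, if_true]
  split_ifs
  · linear_combination theta_mul_theta
  · ring

lemma sum_delta_mul_G_inr (l m : Ln) : ∑ i, δ l i * G i (Sum.inr m) = θ := by
  rw [sum_mul_G_inr]
  simp only [delta_inl, delta_inr, sum_incidence]
  split_ifs <;> ring

lemma delta_sub_delta_mem_Rad (l m : Ln) : δ l - δ m ∈ Rad := by
  rw [mem_Rad_iff]
  rintro (q | n) <;>
    simp [sub_mul, Finset.sum_sub_distrib, -Fintype.sum_sum_type, sum_delta_mul_G_inl,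
      sum_delta_mul_G_inr]

lemma sum_inr_eq_zero_of_mem_Rad {u : (Pt ⊕ Ln) → ℂ} (hu : u ∈ Rad) (m : Ln) :
    ∑ l : Ln, u (Sum.inr l) = 0 := by
  rw [mem_Rad_iff] at hu
  have hp : ∀ q : Pt, 3 * u (Sum.inl q) =
      θ * ∑ l : Ln, u (Sum.inr l) * if q.1 ≤ l.1 then 1 else 0 := fun q =>
    sub_eq_zero.1 (by rw [← sum_mul_G_inl, hu])
  have hl := hu (Sum.inr m)
  rw [sum_mul_G_inr] at hl
  have hs : 3 * ∑ p : Pt, u (Sum.inl p) * (if p.1 ≤ m.1 then 1 else 0) =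
      θ * (∑ l : Ln, u (Sum.inr l) + 3 * u (Sum.inr m)) := by
    calc 3 * ∑ p : Pt, u (Sum.inl p) * (if p.1 ≤ m.1 then 1 else 0)
        = ∑ p : Pt, θ * ∑ l : Ln, u (Sum.inr l) *
            ((if p.1 ≤ l.1 then 1 else 0) * (if p.1 ≤ m.1 then 1 else 0)) := by
          rw [Finset.mul_sum]
          refine Finset.sum_congr rfl fun p _ => ?_
          rw [← mul_assoc, hp, mul_assoc, Finset.sum_mul]
          simp only [mul_assoc]
      _ = θ * ∑ l : Ln, u (Sum.inr l) * (1 + if l = m then 3 else 0) := by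
          rw [← Finset.mul_sum, Finset.sum_comm]
          simp only [← Finset.mul_sum, sum_incidence]
      _ = θ * (∑ l : Ln, u (Sum.inr l) + 3 * u (Sum.inr m)) := by
          simp only [mul_add, Finset.sum_add_distrib, mul_one, mul_ite, mul_zero,
            Finset.sum_ite_eq', Finset.mem_univ, if_true]
          ring
  linear_combination (-1 : ℂ) * hl + (θ / 3) * hs
    + (∑ l : Ln, u (Sum.inr l) + 3 * u (Sum.inr m)) / 3 * theta_mul_theta

lemma eq_sum_smul_delta_of_mem_Rad {u : (Pt ⊕ Ln) → ℂ} (hu : u ∈ Rad) :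
    u = ∑ l : Ln, (θ / 3 * u (Sum.inr l)) • δ l := by
  rw [mem_Rad_iff] at hu
  ext (q | m)
  · have hq := hu (Sum.inl q)
    rw [sum_mul_G_inl] at hq
    simp only [Finset.sum_apply, Pi.smul_apply, smul_eq_mul, delta_inl, mul_assoc,
      ← Finset.mul_sum]
    linear_combination hq / 3
  · simp only [Finset.sum_apply, Pi.smul_apply, smul_eq_mul, delta_inr, mul_ite, mul_zero,
      Finset.sum_ite_eq', Finset.mem_univ, if_true]
    linear_combination (u (Sum.inr m) / 3) * theta_mul_theta

lemma linearIndependent_delta : LinearIndependent ℂ δ := by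
  rw [Fintype.linearIndependent_iff]
  intro c hc m
  have := congrFun hc (Sum.inr m)
  simpa [Finset.sum_apply, delta_inr, theta_ne_zero] using this

/-- The radical as a subspace. -/
def radSubmodule : Submodule ℂ ((Pt ⊕ Ln) → ℂ) where
  carrier := Rad
  add_mem' ha hb v := by
    have := ha v
    have := hb v
    simp_all [B, add_mul, Finset.sum_add_distrib]
  zero_mem' v := by simp [B]
  smul_mem' c u hu v := by
    have := hu v
    simp_all only [B, Pi.smul_apply, smul_eq_mul, mul_assoc, ← Finset.mul_sum, mul_zero]

lemma coe_span_delta_sub_delta :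
    (Submodule.span ℂ {x | ∃ l m : Ln, x = δ l - δ m} : Set ((Pt ⊕ Ln) → ℂ)) = Rad := by
  apply Set.Subset.antisymm
  · change Submodule.span ℂ _ ≤ radSubmodule
    rw [Submodule.span_le]
    rintro _ ⟨l, m, rfl⟩
    exact delta_sub_delta_mem_Rad l m
  · intro u hu
    obtain ⟨m⟩ : Nonempty Ln := Fintype.card_pos_iff.1 (by rw [card_Ln]; norm_num)
    have h : u = ∑ l : Ln, (θ / 3 * u (Sum.inr l)) • (δ l - δ m) := by
      simp only [smul_sub, Finset.sum_sub_distrib, ← Finset.sum_smul, ← Finset.mul_sum,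
        sum_inr_eq_zero_of_mem_Rad hu m, mul_zero, zero_smul, sub_zero]
      exact eq_sum_smul_delta_of_mem_Rad hu
    rw [h]
    exact Submodule.sum_mem _ fun l _ => Submodule.smul_mem _ _ (Submodule.subset_span ⟨l, m, rfl⟩)

lemma finrank_span_delta_sub_delta :
    Module.finrank ℂ (Submodule.span ℂ {x | ∃ l m : Ln, x = δ l - δ m}) = 12 := by
  have h : {x | ∃ l m : Ln, x = δ l - δ m} = Set.range δ -ᵥ Set.range δ := by
    ext x
    simp [Set.mem_vsub, eq_comm]
  rw [h]
  exact linearIndependent_delta.affineIndependent.finrank_vectorSpan card_Ln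

/-- For any two lines `l, m`, the vector `δ_l - δ_m` lies in the
radical of the form, the linear span of all such vectors is exactly the
radical, and this span has dimension `12`. -/
theorem delta_differences_span_radical :
    (∀ l m : Ln, δ l - δ m ∈ Rad) ∧
    (Submodule.span ℂ {x | ∃ l m : Ln, x = δ l - δ m} : Set ((Pt ⊕ Ln) → ℂ)) = Rad ∧
    Module.finrank ℂ (Submodule.span ℂ {x | ∃ l m : Ln, x = δ l - δ m}) = 12 := by
  exact ⟨delta_sub_delta_mem_Rad, coe_span_delta_sub_delta, finrank_span_delta_sub_delta⟩

end

end AllcockStmt13
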